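/- Farkas characterization of trajectory infeasibility. For fixed binary sequences μ ∈ ({0,1}^{n_μ})^K and ν ∈ ({0,1}^{n_ν})^K, the pair (μ, ν) is trajectory-infeasible if and only if there exists a Farkas certificate for (μ, ν), i.e., sequences λ[0],…,λ[K−1] ∈ ℝ^{n_c} and π[0],…,π[K] ∈ ℝ^{n_x} satisfying: (a) λ[k] ≥ 0 componentwise for all 0 ≤ k ≤ K−1; (b) Aᵀπ[k+1] = π[k] + Cᵀλ[k] for all 0 ≤ k ≤ K−1; (c) Bᵀπ[k+1] = Dᵀλ[k] for all 0 ≤ k ≤ K−1; (e) π[K] = 0; and (d) x₀ᵀπ[0] + Σ_{k=0}^{K−1} (G_μ μ[k])ᵀ π[k+1] + Σ_{k=0}^{K−1} (h − H_μ μ[k] − H_ν ν[k])ᵀ λ[k] < 0. -/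

import Mathlib

open Matrix

/-- A real vector is binary if every entry is `0` or `1`. -/
def IsBinaryVec {n : ℕ} (v : Fin n → ℝ) : Prop := ∀ i, v i = 0 ∨ v i = 1

/-- The pair `(μ, ν)` of binary sequences is trajectory-feasible. -/
def TrajFeasible (K n_x n_u nμ nν n_c : ℕ)
    (A : Matrix (Fin n_x) (Fin n_x) ℝ) (B : Matrix (Fin n_x) (Fin n_u) ℝ)
    (Gμ : Matrix (Fin n_x) (Fin nμ) ℝ)
    (C : Matrix (Fin n_c) (Fin n_x) ℝ) (D : Matrix (Fin n_c) (Fin n_u) ℝ)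
    (Hμ : Matrix (Fin n_c) (Fin nμ) ℝ) (Hν : Matrix (Fin n_c) (Fin nν) ℝ)
    (h : Fin n_c → ℝ) (x0 : Fin n_x → ℝ)
    (μ : Fin K → Fin nμ → ℝ) (ν : Fin K → Fin nν → ℝ) : Prop :=
  ∃ (x : Fin (K + 1) → Fin n_x → ℝ) (u : Fin K → Fin n_u → ℝ),
    x 0 = x0 ∧
    (∀ k : Fin K, x k.succ = A.mulVec (x k.castSucc) + B.mulVec (u k) + Gμ.mulVec (μ k)) ∧
    (∀ k : Fin K, ∀ i,
      (C.mulVec (x k.castSucc) + D.mulVec (u k) + Hμ.mulVec (μ k) + Hν.mulVec (ν k)) i ≤ h i)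

/-- A Farkas certificate `(λ, π)` of infeasibility for the pair `(μ, ν)`:
(a) `λ[k] ≥ 0`, (b) `Aᵀπ[k+1] = π[k] + Cᵀλ[k]`, (c) `Bᵀπ[k+1] = Dᵀλ[k]`,
(e) `π[K] = 0`, and (d) the strict inequality
`x₀ᵀπ[0] + Σ (G_μ μ[k])ᵀπ[k+1] + Σ (h − H_μ μ[k] − H_ν ν[k])ᵀλ[k] < 0`. -/
def FarkasCert (K n_x n_u nμ nν n_c : ℕ)
    (A : Matrix (Fin n_x) (Fin n_x) ℝ) (B : Matrix (Fin n_x) (Fin n_u) ℝ)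
    (Gμ : Matrix (Fin n_x) (Fin nμ) ℝ)
    (C : Matrix (Fin n_c) (Fin n_x) ℝ) (D : Matrix (Fin n_c) (Fin n_u) ℝ)
    (Hμ : Matrix (Fin n_c) (Fin nμ) ℝ) (Hν : Matrix (Fin n_c) (Fin nν) ℝ)
    (h : Fin n_c → ℝ) (x0 : Fin n_x → ℝ)
    (μ : Fin K → Fin nμ → ℝ) (ν : Fin K → Fin nν → ℝ)
    (lam : Fin K → Fin n_c → ℝ) (pi : Fin (K + 1) → Fin n_x → ℝ) : Prop :=
  (∀ k : Fin K, ∀ i, 0 ≤ lam k i) ∧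
  (∀ k : Fin K, Aᵀ.mulVec (pi k.succ) = pi k.castSucc + Cᵀ.mulVec (lam k)) ∧
  (∀ k : Fin K, Bᵀ.mulVec (pi k.succ) = Dᵀ.mulVec (lam k)) ∧
  pi (Fin.last K) = 0 ∧
  x0 ⬝ᵥ pi 0 + (∑ k : Fin K, Gμ.mulVec (μ k) ⬝ᵥ pi k.succ)
    + (∑ k : Fin K, (h - Hμ.mulVec (μ k) - Hν.mulVec (ν k)) ⬝ᵥ lam k) < 0

/-- **Farkas' lemma**, homogeneous form over an arbitrary real vector space: a linear functional
that is nonpositive wherever finitely many others are is a nonnegative combination of them. -/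
theorem exists_nonneg_combination_of_nonpos_imp {V ι : Type*} [AddCommGroup V] [Module ℝ V]
    (s : Finset ι) (f : ι → V →ₗ[ℝ] ℝ) (g : V →ₗ[ℝ] ℝ)
    (hg : ∀ v, (∀ i ∈ s, f i v ≤ 0) → g v ≤ 0) :
    ∃ y : ι → ℝ, (∀ i, 0 ≤ y i) ∧ ∀ v, g v = ∑ i ∈ s, y i * f i v := by
  classical
  induction s using Finset.induction_on generalizing f g with
  | empty =>
    refine ⟨0, fun _ => le_rfl, fun v => ?_⟩
    have h₁ := hg v (by simp)
    have h₂ := hg (-v) (by simp)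
    rw [map_neg] at h₂
    simp only [Finset.sum_empty]
    linarith
  | insert a s ha ih =>
    by_cases hs : ∀ v, (∀ i ∈ s, f i v ≤ 0) → g v ≤ 0
    · obtain ⟨y, hy, hgy⟩ := ih f g hs
      refine ⟨Function.update y a 0, fun i => ?_, fun v => ?_⟩
      · rcases eq_or_ne i a with rfl | hi
        · simp
        · simpa [hi] using hy i
      · rw [Finset.sum_insert ha, hgy v]
        simp only [Function.update_self, zero_mul, zero_add]
        refine Finset.sum_congr rfl fun i hi => ?_
        rw [Function.update_of_ne (ne_of_mem_of_not_mem hi ha)]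
    · push Not at hs
      obtain ⟨w, hw, hgw⟩ := hs
      have haw : 0 < f a w := by
        by_contra! hle
        exact hgw.not_ge (hg w (by simpa using ⟨hle, hw⟩))
      -- Project along `w` onto the kernel of `f a`.
      let P : V →ₗ[ℝ] V := LinearMap.id - ((f a w)⁻¹ • f a).smulRight w
      have hP : ∀ (l : V →ₗ[ℝ] ℝ) v, l (P v) = l v - (f a w)⁻¹ * f a v * l w := by
        intro l v
        simp [P]
      obtain ⟨y, hy, hgy⟩ := ih (fun i => f i ∘ₗ P) (g ∘ₗ P) (by
        intro v hv
        refine hg (P v) ?_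
        simp only [Finset.mem_insert, forall_eq_or_imp]
        refine ⟨?_, hv⟩
        rw [hP, mul_right_comm, inv_mul_cancel₀ haw.ne', one_mul, sub_self])
      have hsum : ∑ i ∈ s, y i * f i w ≤ 0 :=
        Finset.sum_nonpos fun i hi => mul_nonpos_of_nonneg_of_nonpos (hy i) (hw i hi)
      refine ⟨Function.update y a ((f a w)⁻¹ * (g w - ∑ i ∈ s, y i * f i w)),
        fun i => ?_, fun v => ?_⟩
      · rcases eq_or_ne i a with rfl | hi
        · rw [Function.update_self]
          exact mul_nonneg (inv_nonneg.2 haw.le) (by linarith)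
        · simpa [hi] using hy i
      · rw [Finset.sum_insert ha, Function.update_self]
        have hrest : ∑ i ∈ s, Function.update y a
            ((f a w)⁻¹ * (g w - ∑ i ∈ s, y i * f i w)) i * f i v = ∑ i ∈ s, y i * f i v :=
          Finset.sum_congr rfl fun i hi => by
            rw [Function.update_of_ne (ne_of_mem_of_not_mem hi ha)]
        have hv := hgy v
        simp only [LinearMap.comp_apply, hP, mul_sub, Finset.sum_sub_distrib] at hv
        have hfactor : ∑ i ∈ s, y i * ((f a w)⁻¹ * f a v * f i w)
            = (f a w)⁻¹ * f a v * ∑ i ∈ s, y i * f i w := by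
          rw [Finset.mul_sum]
          exact Finset.sum_congr rfl fun i _ => by ring
        rw [hfactor] at hv
        rw [hrest]
        linear_combination hv

/-- **Farkas' lemma**, affine form: an inconsistent finite system `f i v ≤ b i` has nonnegative
multipliers that combine it to `0 ≤ β` with `β < 0`. -/
theorem exists_nonneg_multipliers_of_inconsistent {V ι : Type*} [AddCommGroup V] [Module ℝ V]
    [Fintype ι] (f : ι → V →ₗ[ℝ] ℝ) (b : ι → ℝ) (hf : ¬ ∃ v, ∀ i, f i v ≤ b i) :
    ∃ y : ι → ℝ, (∀ i, 0 ≤ y i) ∧ (∀ v, ∑ i, y i * f i v = 0) ∧ ∑ i, y i * b i < 0 := by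
  let F : Option ι → V × ℝ →ₗ[ℝ] ℝ := fun o =>
    o.elim (-LinearMap.snd ℝ V ℝ)
      fun i => f i ∘ₗ LinearMap.fst ℝ V ℝ - b i • LinearMap.snd ℝ V ℝ
  obtain ⟨y, hy, hgy⟩ := exists_nonneg_combination_of_nonpos_imp Finset.univ F
    (LinearMap.snd ℝ V ℝ) (by
      rintro ⟨v, t⟩ hv
      by_contra! ht
      replace ht : 0 < t := ht
      refine hf ⟨t⁻¹ • v, fun i => ?_⟩
      have hi : f i v - b i * t ≤ 0 := by simpa [F] using hv (some i) (Finset.mem_univ _)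
      rw [map_smul, smul_eq_mul, inv_mul_le_iff₀ ht]
      linarith)
  refine ⟨fun i => y (some i), fun i => hy _, fun v => ?_, ?_⟩
  · simpa [F, Fintype.sum_option] using (hgy (v, 0)).symm
  · have h₁ := hgy (0, 1)
    simp only [Fintype.sum_option, F, Option.elim, LinearMap.neg_apply, LinearMap.sub_apply,
      LinearMap.comp_apply, LinearMap.smul_apply, LinearMap.fst_apply, LinearMap.snd_apply,
      map_zero, smul_eq_mul, mul_one, zero_sub, mul_neg, Finset.sum_neg_distrib] at h₁
    linarith [hy none]

/-- **Farkas' lemma** for a mixed system `F v ≤ b`, `E v = c`: the multipliers of the equations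
are unrestricted in sign. -/
theorem exists_multipliers_of_inconsistent {V ι κ : Type*} [AddCommGroup V] [Module ℝ V]
    [Fintype ι] [Fintype κ] (F : V →ₗ[ℝ] ι → ℝ) (b : ι → ℝ) (E : V →ₗ[ℝ] κ → ℝ) (c : κ → ℝ)
    (h : ¬ ∃ v, F v ≤ b ∧ E v = c) :
    ∃ (y : ι → ℝ) (z : κ → ℝ), (∀ i, 0 ≤ y i) ∧ (∀ v, F v ⬝ᵥ y + E v ⬝ᵥ z = 0) ∧
      b ⬝ᵥ y + c ⬝ᵥ z < 0 := by
  obtain ⟨y, hy, hyf, hyb⟩ := exists_nonneg_multipliers_of_inconsistent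
    (Sum.elim (fun i => LinearMap.proj i ∘ₗ F)
      (Sum.elim (fun j => LinearMap.proj j ∘ₗ E) (fun j => -(LinearMap.proj j ∘ₗ E))))
    (Sum.elim b (Sum.elim c (-c))) (by
      rintro ⟨v, hv⟩
      refine h ⟨v, fun i => hv (.inl i), funext fun j => le_antisymm (hv (.inr (.inl j))) ?_⟩
      simpa using hv (.inr (.inr j)))
  refine ⟨fun i => y (.inl i), fun j => y (.inr (.inl j)) - y (.inr (.inr j)),
    fun i => hy _, fun v => ?_, ?_⟩
  · rw [← hyf v]
    simp [dotProduct, add_mul, Finset.sum_add_distrib, mul_comm, sub_eq_add_neg]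
  · refine lt_of_eq_of_lt ?_ hyb
    simp [dotProduct, mul_add, Finset.sum_add_distrib, mul_comm, sub_eq_add_neg]

/-- Summation by parts: moving the multipliers of the dynamics onto states and inputs. -/
theorem sum_multipliers_eq_sum_adjoint {K : ℕ} {X U W : Type*} [Fintype X] [Fintype U] [Fintype W]
    (A : Matrix X X ℝ) (B : Matrix X U ℝ) (C : Matrix W X ℝ) (D : Matrix W U ℝ)
    (x : Fin (K + 1) → X → ℝ) (u : Fin K → U → ℝ)
    (lam : Fin K → W → ℝ) (p : Fin (K + 1) → X → ℝ) :
    ∑ k : Fin K, (C *ᵥ x k.castSucc + D *ᵥ u k) ⬝ᵥ lam k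
      + (x 0 ⬝ᵥ p 0
        + ∑ k : Fin K, (x k.succ - A *ᵥ x k.castSucc - B *ᵥ u k) ⬝ᵥ p k.succ)
    = ∑ k : Fin K, x k.castSucc ⬝ᵥ (p k.castSucc + Cᵀ *ᵥ lam k - Aᵀ *ᵥ p k.succ)
      + ∑ k : Fin K, u k ⬝ᵥ (Dᵀ *ᵥ lam k - Bᵀ *ᵥ p k.succ)
      + x (Fin.last K) ⬝ᵥ p (Fin.last K) := by
  have htel := (Fin.sum_univ_succ fun j => x j ⬝ᵥ p j).symm.trans
    (Fin.sum_univ_castSucc fun j => x j ⬝ᵥ p j)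
  simp only [add_dotProduct, sub_dotProduct, dotProduct_add, dotProduct_sub,
    dotProduct_transpose_mulVec, dotProduct_comm (_ *ᵥ _), Finset.sum_add_distrib, Finset.sum_sub_distrib]
  linear_combination htel

/-- **Farkas characterization of trajectory infeasibility.** For fixed binary sequences
`μ` and `ν`, the pair `(μ, ν)` is trajectory-infeasible if and only if there exists a
Farkas certificate for `(μ, ν)`. -/
theorem farkas_characterization_of_infeasibility
    (K n_x n_u nμ nν n_c : ℕ) (hK : 0 < K)
    (A : Matrix (Fin n_x) (Fin n_x) ℝ) (B : Matrix (Fin n_x) (Fin n_u) ℝ)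
    (Gμ : Matrix (Fin n_x) (Fin nμ) ℝ)
    (C : Matrix (Fin n_c) (Fin n_x) ℝ) (D : Matrix (Fin n_c) (Fin n_u) ℝ)
    (Hμ : Matrix (Fin n_c) (Fin nμ) ℝ) (Hν : Matrix (Fin n_c) (Fin nν) ℝ)
    (h : Fin n_c → ℝ) (x0 : Fin n_x → ℝ)
    (μ : Fin K → Fin nμ → ℝ) (hμbin : ∀ k, IsBinaryVec (μ k))
    (ν : Fin K → Fin nν → ℝ) (hνbin : ∀ k, IsBinaryVec (ν k)) :
    ¬ TrajFeasible K n_x n_u nμ nν n_c A B Gμ C D Hμ Hν h x0 μ ν ↔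
      ∃ (lam : Fin K → Fin n_c → ℝ) (pi : Fin (K + 1) → Fin n_x → ℝ),
        FarkasCert K n_x n_u nμ nν n_c A B Gμ C D Hμ Hν h x0 μ ν lam pi := by
  constructor
  · intro hinf
    let F : ((Fin (K + 1) → Fin n_x → ℝ) × (Fin K → Fin n_u → ℝ)) →ₗ[ℝ] Fin K × Fin n_c → ℝ :=
      { toFun := fun q i => (C *ᵥ q.1 i.1.castSucc + D *ᵥ q.2 i.1) i.2
        map_add' := fun q r => by
          ext i
          simp only [Prod.fst_add, Prod.snd_add, Pi.add_apply, mulVec_add]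
          ring
        map_smul' := fun a q => by
          ext i
          simp only [Prod.smul_fst, Prod.smul_snd, Pi.smul_apply, Pi.add_apply, mulVec_smul,
            RingHom.id_apply, smul_eq_mul]
          ring }
    let E : ((Fin (K + 1) → Fin n_x → ℝ) × (Fin K → Fin n_u → ℝ)) →ₗ[ℝ]
        Fin n_x ⊕ Fin K × Fin n_x → ℝ :=
      { toFun := fun q => Sum.elim (q.1 0)
          fun i => (q.1 i.1.succ - A *ᵥ q.1 i.1.castSucc - B *ᵥ q.2 i.1) i.2
        map_add' := fun q r => by
          ext (i | i)
          · simp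
          · simp only [Prod.fst_add, Prod.snd_add, Pi.add_apply, Pi.sub_apply, mulVec_add,
              Sum.elim_inr]
            ring
        map_smul' := fun a q => by
          ext (i | i)
          · simp
          · simp only [Prod.smul_fst, Prod.smul_snd, Pi.smul_apply, Pi.sub_apply, mulVec_smul,
              RingHom.id_apply, smul_eq_mul, Sum.elim_inr]
            ring }
    obtain ⟨y, z, hy, hstat, hneg⟩ := exists_multipliers_of_inconsistent F
      (fun i => (h - Hμ *ᵥ μ i.1 - Hν *ᵥ ν i.1) i.2) E
      (Sum.elim x0 fun i => (Gμ *ᵥ μ i.1) i.2) (by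
        rintro ⟨⟨x, u⟩, hF, hE⟩
        refine hinf ⟨x, u, funext fun i => congrFun hE (.inl i), fun k => funext fun i => ?_,
          fun k i => ?_⟩
        · have hi := congrFun hE (.inr (k, i))
          simp only [E, LinearMap.coe_mk, AddHom.coe_mk, Sum.elim_inr, Pi.sub_apply] at hi
          simp only [Pi.add_apply]
          linarith
        · have hi := hF (k, i)
          simp only [F, LinearMap.coe_mk, AddHom.coe_mk, Pi.sub_apply, Pi.add_apply] at hi
          simp only [Pi.add_apply]
          linarith)
    let lam : Fin K → Fin n_c → ℝ := fun k i => y (k, i)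
    let p : Fin (K + 1) → Fin n_x → ℝ :=
      Fin.cons (fun i => z (.inl i)) fun k i => z (.inr (k, i))
    have hadj := fun x u => (sum_multipliers_eq_sum_adjoint A B C D x u lam p).symm.trans <| by
      have hxu := hstat (x, u)
      simp only [F, E, LinearMap.coe_mk, AddHom.coe_mk, dotProduct, Fintype.sum_sum_type,
        Fintype.sum_prod_type, Sum.elim_inl, Sum.elim_inr] at hxu
      exact hxu
    -- Testing the stationarity identity against the residuals makes it a vanishing sum of squares.
    have hsq := hadj
      (Fin.snoc (fun k => p k.castSucc + Cᵀ *ᵥ lam k - Aᵀ *ᵥ p k.succ) (p (Fin.last K)))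
      (fun k => Dᵀ *ᵥ lam k - Bᵀ *ᵥ p k.succ)
    simp only [Fin.snoc_castSucc, Fin.snoc_last] at hsq
    have hnn : ∀ {n : ℕ} (v : Fin n → ℝ), 0 ≤ v ⬝ᵥ v := fun v =>
      Finset.sum_nonneg fun i _ => mul_self_nonneg (v i)
    have hx := Finset.sum_nonneg fun (k : Fin K) (_ : k ∈ Finset.univ) =>
      hnn (p k.castSucc + Cᵀ *ᵥ lam k - Aᵀ *ᵥ p k.succ)
    have hu := Finset.sum_nonneg fun (k : Fin K) (_ : k ∈ Finset.univ) =>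
      hnn (Dᵀ *ᵥ lam k - Bᵀ *ᵥ p k.succ)
    have hl := hnn (p (Fin.last K))
    have hx0 := (Finset.sum_eq_zero_iff_of_nonneg fun k _ => hnn _).1
      (show ∑ k : Fin K, _ = 0 from le_antisymm (by linarith) hx)
    have hu0 := (Finset.sum_eq_zero_iff_of_nonneg fun k _ => hnn _).1
      (show ∑ k : Fin K, _ = 0 from le_antisymm (by linarith) hu)
    refine ⟨lam, p, fun k i => hy (k, i), fun k => ?_, fun k => ?_, ?_, ?_⟩
    · exact (sub_eq_zero.1 (dotProduct_self_eq_zero.1 (hx0 k (Finset.mem_univ k)))).symm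
    · exact (sub_eq_zero.1 (dotProduct_self_eq_zero.1 (hu0 k (Finset.mem_univ k)))).symm
    · exact dotProduct_self_eq_zero.1 (by linarith)
    · simp only [dotProduct, Fintype.sum_sum_type, Fintype.sum_prod_type, Sum.elim_inl,
        Sum.elim_inr] at hneg
      refine lt_of_eq_of_lt ?_ hneg
      rw [add_comm]
      rfl
  · rintro ⟨lam, p, hlam, hA, hB, hK0, hneg⟩ ⟨x, u, hx0, hdyn, hcon⟩
    have hadj := sum_multipliers_eq_sum_adjoint A B C D x u lam p
    have hres : ∀ k : Fin K, x k.succ - A *ᵥ x k.castSucc - B *ᵥ u k = Gμ *ᵥ μ k := by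
      intro k
      rw [hdyn k]
      abel
    simp only [← hA, ← hB, hK0, hres, hx0, sub_self, dotProduct_zero,
      Finset.sum_const_zero, add_zero] at hadj
    have hle : ∑ k : Fin K, (C *ᵥ x k.castSucc + D *ᵥ u k) ⬝ᵥ lam k
        ≤ ∑ k : Fin K, (h - Hμ *ᵥ μ k - Hν *ᵥ ν k) ⬝ᵥ lam k := by
      refine Finset.sum_le_sum fun k _ => dotProduct_le_dotProduct_of_nonneg_right ?_ (hlam k)
      intro i
      have hi := hcon k i
      simp only [Pi.add_apply, Pi.sub_apply] at hi ⊢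
      linarith
    linarith
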